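/- arXiv:0710.1929 — 2 statements merged into one kernel-verified Lean document; each statement's English description precedes it below -/
import Mathlib

section
/- Let Δ₁ and Δ₂ be nonzero polynomials in ℚ[t] whose greatest common divisor is a unit, and let M₁ and M₂ be modules over Λ = ℚ[t, t⁻¹] such that ι(Δ₁)·x = 0 for all x ∈ M₁ and ι(Δ₂)·y = 0 for all y ∈ M₂. Then every Λ-submodule P of M₁ × M₂ satisfies P = P₁ × P₂, where P₁ = {x ∈ M₁ | (x, 0) ∈ P} and P₂ = {y ∈ M₂ | (0, y) ∈ P}. -/
/-- Let `Δ₁, Δ₂` be nonzero rational polynomials with unit gcd, and let `M₁, M₂` be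
modules over `Λ = ℚ[t,t⁻¹]` annihilated by `ι(Δ₁)` and `ι(Δ₂)` respectively.
Then every `Λ`-submodule of `M₁ × M₂` splits as `P₁ × P₂` with
`P₁ = {x | (x,0) ∈ P}` and `P₂ = {y | (0,y) ∈ P}`. -/
theorem submodule_prod_of_coprime_alexander_polynomials
    (Δ₁ Δ₂ : Polynomial ℚ) (h₁ : Δ₁ ≠ 0) (h₂ : Δ₂ ≠ 0)
    (hcop : IsUnit (gcd Δ₁ Δ₂))
    {M₁ M₂ : Type*}
    [AddCommGroup M₁] [Module (LaurentPolynomial ℚ) M₁]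
    [AddCommGroup M₂] [Module (LaurentPolynomial ℚ) M₂]
    (ha : ∀ x : M₁, (Polynomial.toLaurent Δ₁) • x = 0)
    (hb : ∀ y : M₂, (Polynomial.toLaurent Δ₂) • y = 0)
    (P : Submodule (LaurentPolynomial ℚ) (M₁ × M₂)) :
    P = (P.comap (LinearMap.inl (LaurentPolynomial ℚ) M₁ M₂)).prod
        (P.comap (LinearMap.inr (LaurentPolynomial ℚ) M₁ M₂)) := by
  have hc : IsCoprime Δ₁ Δ₂ := (gcd_isUnit_iff Δ₁ Δ₂).1 hcop
  obtain ⟨a, b, hab⟩ := hc.map (Polynomial.toLaurent (R := ℚ))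
  have hx : ∀ x : M₁, (b * Polynomial.toLaurent Δ₂) • x = x := by
    intro x
    have h : (a * Polynomial.toLaurent Δ₁ + b * Polynomial.toLaurent Δ₂) • x = x := by
      rw [hab, one_smul]
    rwa [add_smul, mul_smul a, ha, smul_zero, zero_add] at h
  have hy : ∀ y : M₂, (a * Polynomial.toLaurent Δ₁) • y = y := by
    intro y
    have h : (a * Polynomial.toLaurent Δ₁ + b * Polynomial.toLaurent Δ₂) • y = y := by
      rw [hab, one_smul]
    rwa [add_smul, mul_smul b, hb, smul_zero, add_zero] at h
  ext ⟨x, y⟩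
  simp only [Submodule.mem_prod, Submodule.mem_comap, LinearMap.inl_apply, LinearMap.inr_apply]
  constructor
  · intro h
    constructor
    · have := P.smul_mem (b * Polynomial.toLaurent Δ₂) h
      rwa [Prod.smul_mk, hx, mul_smul, hb, smul_zero] at this
    · have := P.smul_mem (a * Polynomial.toLaurent Δ₁) h
      rwa [Prod.smul_mk, hy, mul_smul, ha, smul_zero] at this
  · rintro ⟨h, h'⟩
    simpa using P.add_mem h h'
end

section
/- Suppose in addition that a, b ∈ R are coprime elements (there exist f, g ∈ R with f·a + g·b = 1) with a·x = 0 for all x ∈ M₁ and b·y = 0 for all y ∈ M₂. If an R-submodule P of M₁ × M₂ is self-annihilating with respect to the orthogonal sum form B, then P = P₁ × P₂ where P₁ = {x ∈ M₁ | (x, 0) ∈ P} and P₂ = {y ∈ M₂ | (0, y) ∈ P}, and moreover P₁ is self-annihilating with respect to B₁ and P₂ is self-annihilating with respect to B₂. -/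
/-- Suppose `a, b ∈ R` are coprime, `a` annihilates `M₁` and `b` annihilates `M₂`.
If a submodule `P` of `M₁ × M₂` is self-annihilating with respect to the orthogonal
sum form `B`, then `P = P₁ × P₂` with `P₁ = {x | (x,0) ∈ P}`, `P₂ = {y | (0,y) ∈ P}`,
and `P₁`, `P₂` are self-annihilating with respect to `B₁`, `B₂` respectively. -/
theorem self_annihilating_splits
    {R : Type*} [CommRing R] {M₁ M₂ Q : Type*}
    [AddCommGroup M₁] [Module R M₁] [AddCommGroup M₂] [Module R M₂]
    [AddCommGroup Q] [Module R Q]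
    (B₁ : M₁ → M₁ → Q) (B₂ : M₂ → M₂ → Q)
    (hB₁l : ∀ x x' y, B₁ (x + x') y = B₁ x y + B₁ x' y)
    (hB₁r : ∀ x y y', B₁ x (y + y') = B₁ x y + B₁ x y')
    (hB₂l : ∀ x x' y, B₂ (x + x') y = B₂ x y + B₂ x' y)
    (hB₂r : ∀ x y y', B₂ x (y + y') = B₂ x y + B₂ x y')
    (a b f g : R) (hfg : f * a + g * b = 1)
    (ha : ∀ x : M₁, a • x = 0) (hb : ∀ y : M₂, b • y = 0)
    (P : Submodule R (M₁ × M₂))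
    (hP : (↑P : Set (M₁ × M₂))
        = {z : M₁ × M₂ | ∀ w ∈ P, B₁ w.1 z.1 + B₂ w.2 z.2 = 0}) :
    P = (P.comap (LinearMap.inl R M₁ M₂)).prod (P.comap (LinearMap.inr R M₁ M₂)) ∧
    (↑(P.comap (LinearMap.inl R M₁ M₂)) : Set M₁)
        = {x : M₁ | ∀ w ∈ P.comap (LinearMap.inl R M₁ M₂), B₁ w x = 0} ∧
    (↑(P.comap (LinearMap.inr R M₁ M₂)) : Set M₂)
        = {y : M₂ | ∀ w ∈ P.comap (LinearMap.inr R M₁ M₂), B₂ w y = 0} := by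
  have z1l : ∀ y, B₁ 0 y = 0 := fun y => by simpa using hB₁l 0 0 y
  have z1r : ∀ x, B₁ x 0 = 0 := fun x => by simpa using hB₁r x 0 0
  have z2l : ∀ y, B₂ 0 y = 0 := fun y => by simpa using hB₂l 0 0 y
  have z2r : ∀ x, B₂ x 0 = 0 := fun x => by simpa using hB₂r x 0 0
  have e1 : ∀ x : M₁, (g * b) • x = x := fun x => by
    have h : (f * a + g * b) • x = x := by rw [hfg, one_smul]
    rwa [add_smul, mul_smul f, ha, smul_zero, zero_add] at h
  have e2 : ∀ y : M₂, (f * a) • y = y := fun y => by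
    have h : (f * a + g * b) • y = y := by rw [hfg, one_smul]
    rwa [add_smul, mul_smul g, hb, smul_zero, add_zero] at h
  have p1 : ∀ w ∈ P, (w.1, (0 : M₂)) ∈ P := fun w hw => by
    have h := P.smul_mem (g * b) hw
    have e : (g * b) • w = (w.1, (0 : M₂)) :=
      Prod.ext (e1 w.1) (by simp [mul_smul, hb])
    rwa [e] at h
  have p2 : ∀ w ∈ P, ((0 : M₁), w.2) ∈ P := fun w hw => by
    have h := P.smul_mem (f * a) hw
    have e : (f * a) • w = ((0 : M₁), w.2) :=
      Prod.ext (by simp [mul_smul, ha]) (e2 w.2)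
    rwa [e] at h
  have key : ∀ z : M₁ × M₂, z ∈ P ↔ ∀ w ∈ P, B₁ w.1 z.1 + B₂ w.2 z.2 = 0 := fun z => by
    rw [← SetLike.mem_coe, hP]; rfl
  refine ⟨?_, ?_, ?_⟩
  · ext ⟨x, y⟩
    simp only [Submodule.mem_prod, Submodule.mem_comap, LinearMap.inl_apply, LinearMap.inr_apply]
    refine ⟨fun h => ⟨p1 _ h, p2 _ h⟩, fun h => ?_⟩
    simpa using P.add_mem h.1 h.2
  · ext x
    simp only [SetLike.mem_coe, Submodule.mem_comap, LinearMap.inl_apply, Set.mem_setOf_eq]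
    constructor
    · intro h w hw
      simpa [z2r] using (key _).1 h _ hw
    · intro h
      refine (key _).2 fun w hw => ?_
      simpa [z2r] using h _ (p1 w hw)
  · ext y
    simp only [SetLike.mem_coe, Submodule.mem_comap, LinearMap.inr_apply, Set.mem_setOf_eq]
    constructor
    · intro h w hw
      simpa [z1r] using (key _).1 h _ hw
    · intro h
      refine (key _).2 fun w hw => ?_
      simpa [z1r] using h _ (p2 w hw)
end
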